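/- arXiv:2102.09128 — 2 statements merged into one kernel-verified Lean document; each statement's English description precedes it below -/
import Mathlib

section
/- Let k ≥ 2, M ≥ 2, N ≥ 1 be integers, α > 0, and Ỹ_1,…,Ỹ_M ∈ ℝ. Let y : [0,1] → ℝ be k times continuously differentiable with |y'(x)| ≤ Q for all x ∈ [0,1]. Let f_* : [0,1] → ℝ be k times continuously differentiable with f_*(0) = y(0), f_*(1) = y(1), and Φ(f_*) ≤ Φ(y) (for instance, f_* minimizes Φ among such functions). Set e = f_* − y. Then ‖e‖ ≤ h_M·‖e'‖ + sqrt(8·Δ_M² + 8·Q²·h_M²/N² + 2·α·‖y^{(k)}‖²). -/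
open MeasureTheory Set

/-- The average of `f` over the `i`-th subinterval `[(i-1)/M, i/M]`. -/
noncomputable def intervalAvg (M : ℕ) (f : ℝ → ℝ) (i : ℕ) : ℝ :=
  (M : ℝ) * ∫ x in (((i : ℝ) - 1) / M)..((i : ℝ) / M), f x

/-- The Tikhonov functional `Φ`. -/
noncomputable def tikhonov (M k : ℕ) (α : ℝ) (Ytil : ℕ → ℝ) (f : ℝ → ℝ) : ℝ :=
  (1 / M) * ∑ i ∈ Finset.Icc 1 M, (Ytil i - intervalAvg M f i) ^ 2
    + α * ∫ x in (0:ℝ)..1, (iteratedDerivWithin k f (Icc 0 1) x) ^ 2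

/-- The exact group means `Y_i = (1/N) ∑_{j=(i−1)N+1}^{iN} y(ĵ/(MN))`. -/
noncomputable def groupMean (M N : ℕ) (y : ℝ → ℝ) (i : ℕ) : ℝ :=
  (1 / N) * ∑ j ∈ Finset.Icc ((i - 1) * N + 1) (i * N), y ((j : ℝ) / (M * N))

/-- The statistic `Δ_M² = (1/M) ∑_{i=1}^M (Ỹ_i − Y_i)²`. -/
noncomputable def deltaSq (M N : ℕ) (Ytil : ℕ → ℝ) (y : ℝ → ℝ) : ℝ :=
  (1 / M) * ∑ i ∈ Finset.Icc 1 M, (Ytil i - groupMean M N y i) ^ 2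

/-- The `L²(0,1)` norm. -/
noncomputable def l2norm (g : ℝ → ℝ) : ℝ :=
  Real.sqrt (∫ x in (0:ℝ)..1, g x ^ 2)


theorem l2norm_sq (g : ℝ → ℝ) : l2norm g ^ 2 = ∫ x in (0:ℝ)..1, g x ^ 2 :=
  Real.sq_sqrt (intervalIntegral.integral_nonneg zero_le_one fun _ _ => sq_nonneg _)

/-- The block `[s + 1, s + n]` enumerated by `range n`. -/
theorem sum_Icc_add_one_eq_sum_range (s n : ℕ) (u : ℕ → ℝ) :
    ∑ j ∈ Finset.Icc (s + 1) (s + n), u j = ∑ t ∈ Finset.range n, u (s + t + 1) := by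
  induction n with
  | zero => simp
  | succ n ih =>
    rw [Finset.sum_range_succ, ← ih, ← add_assoc, Finset.sum_Icc_succ_top (by omega)]

/-- Additivity of the integral over `n` adjacent intervals of length `δ`. -/
theorem sum_integral_grid {g : ℝ → ℝ} {a δ : ℝ} (hδ : 0 ≤ δ) (n : ℕ)
    (hg : ContinuousOn g (Icc a (a + n * δ))) :
    ∑ t ∈ Finset.range n, ∫ x in (a + t * δ)..(a + (t + 1 : ℕ) * δ), g x
      = ∫ x in a..(a + n * δ), g x := by
  have h := intervalIntegral.sum_integral_adjacent_intervals (f := g) (μ := volume)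
    (a := fun t : ℕ => a + t * δ) (n := n) ?_
  · simpa using h
  · intro t ht
    apply ContinuousOn.intervalIntegrable
    have h1 : ((t + 1 : ℕ) : ℝ) ≤ n := by exact_mod_cast ht
    have h2 : (t : ℝ) * δ ≤ (t + 1 : ℕ) * δ := by push_cast; nlinarith
    have h3 : 0 ≤ (t : ℝ) * δ := by positivity
    have h4 : ((t + 1 : ℕ) : ℝ) * δ ≤ n * δ := by gcongr
    rw [uIcc_of_le (by linarith)]
    exact hg.mono (Icc_subset_Icc (by linarith) (by linarith))

theorem sq_integral_abs_le {g : ℝ → ℝ} {a b : ℝ} (hab : a < b) (hg : ContinuousOn g (Icc a b)) :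
    (∫ x in a..b, |g x|) ^ 2 ≤ (b - a) * ∫ x in a..b, g x ^ 2 := by
  rw [← uIcc_of_le hab.le] at hg
  set L := ∫ x in a..b, |g x| with hL
  have hi : IntervalIntegrable (fun x => |g x|) volume a b := hg.abs.intervalIntegrable
  have hi2 : IntervalIntegrable (fun x => g x ^ 2) volume a b := (hg.pow 2).intervalIntegrable
  have hba : 0 < b - a := sub_pos.2 hab
  have h0 : 0 ≤ ∫ x in a..b, (|g x| - L / (b - a)) ^ 2 :=
    intervalIntegral.integral_nonneg hab.le fun x _ => sq_nonneg _
  have h1 : ∫ x in a..b, (|g x| - L / (b - a)) ^ 2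
      = (∫ x in a..b, g x ^ 2) - L ^ 2 / (b - a) := by
    have : ∀ x, (|g x| - L / (b - a)) ^ 2
        = (g x ^ 2 - 2 * (L / (b - a)) * |g x|) + (L / (b - a)) ^ 2 := fun x => by
      rw [sub_sq, sq_abs]; ring
    simp_rw [this]
    rw [intervalIntegral.integral_add (hi2.sub (hi.const_mul _)) (by simp),
      intervalIntegral.integral_sub hi2 (hi.const_mul _), intervalIntegral.integral_const_mul,
      intervalIntegral.integral_const, ← hL, smul_eq_mul]
    field_simp
    ring
  rw [h1, sub_nonneg, div_le_iff₀ hba] at h0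
  linarith

/-- Poincaré–Wirtinger type inequality on an interval, with the mean value on the right-hand
side. -/
theorem integral_sq_le_poincare {e g : ℝ → ℝ} {a b : ℝ} (hab : a < b)
    (he : ContinuousOn e (Icc a b)) (hg : ContinuousOn g (Icc a b))
    (hd : ∀ x ∈ Ioo a b, HasDerivAt e (g x) x) :
    ∫ x in a..b, e x ^ 2
      ≤ (b - a) ^ 2 * (∫ x in a..b, g x ^ 2) + (∫ x in a..b, e x) ^ 2 / (b - a) := by
  have hba : 0 < b - a := sub_pos.2 hab
  have hu : uIcc a b = Icc a b := uIcc_of_le hab.le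
  have hie : IntervalIntegrable e volume a b := (hu ▸ he).intervalIntegrable
  have hie2 : IntervalIntegrable (fun x => e x ^ 2) volume a b :=
    (hu ▸ he.pow 2 : ContinuousOn _ (uIcc a b)).intervalIntegrable
  set L := ∫ x in a..b, |g x| with hL
  set m := (∫ x in a..b, e x) / (b - a) with hm
  have hosc : ∀ x ∈ Icc a b, ∀ z ∈ Icc a b, z ≤ x → |e x - e z| ≤ L := by
    intro x hx z hz hzx
    have hs : Icc z x ⊆ Icc a b := Icc_subset_Icc hz.1 hx.2
    rw [← intervalIntegral.integral_eq_sub_of_hasDerivAt_of_le hzx (he.mono hs)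
      (fun t ht => hd t ⟨hz.1.trans_lt ht.1, ht.2.trans_le hx.2⟩)
      ((uIcc_of_le hzx ▸ hg.mono hs : ContinuousOn g (uIcc z x)).intervalIntegrable)]
    refine (intervalIntegral.abs_integral_le_integral_abs hzx).trans ?_
    exact intervalIntegral.integral_mono_interval hz.1 hzx hx.2
      (Filter.Eventually.of_forall fun t => abs_nonneg _)
      ((hu ▸ hg.abs : ContinuousOn _ (uIcc a b)).intervalIntegrable)
  have hdev : ∀ x ∈ Icc a b, |e x - m| ≤ L := by
    intro x hx
    have h1 : e x - m = (∫ z in a..b, (e x - e z)) / (b - a) := by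
      rw [intervalIntegral.integral_sub (by simp) hie, intervalIntegral.integral_const, hm,
        smul_eq_mul]
      field_simp
    have h2 : ‖∫ z in a..b, (e x - e z)‖ ≤ L * |b - a| := by
      refine intervalIntegral.norm_integral_le_of_norm_le_const fun z hz => ?_
      rw [uIoc_of_le hab.le] at hz
      have hz' := Ioc_subset_Icc_self hz
      rcases le_total z x with h | h
      · exact hosc x hx z hz' h
      · rw [Real.norm_eq_abs, abs_sub_comm]
        exact hosc z hz' x hx h
    rw [h1, abs_div, div_le_iff₀ (abs_pos.2 hba.ne')]
    exact h2
  have hint : ∫ x in a..b, (e x - m) ^ 2 ≤ (b - a) * L ^ 2 := by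
    have : ∫ x in a..b, (e x - m) ^ 2 ≤ ∫ _ in a..b, L ^ 2 := by
      refine intervalIntegral.integral_mono_on hab.le ?_ (by simp) fun x hx => ?_
      · exact (hu ▸ (he.sub continuousOn_const).pow 2 :
          ContinuousOn _ (uIcc a b)).intervalIntegrable
      · rw [← sq_abs]
        exact pow_le_pow_left₀ (abs_nonneg _) (hdev x hx) 2
    simpa using this
  have hexp : ∫ x in a..b, (e x - m) ^ 2
      = (∫ x in a..b, e x ^ 2) - (∫ x in a..b, e x) ^ 2 / (b - a) := by
    have : ∀ x, (e x - m) ^ 2 = (e x ^ 2 - 2 * m * e x) + m ^ 2 := fun x => by ring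
    simp_rw [this]
    rw [intervalIntegral.integral_add (hie2.sub (hie.const_mul _)) (by simp),
      intervalIntegral.integral_sub hie2 (hie.const_mul _), intervalIntegral.integral_const_mul,
      intervalIntegral.integral_const, hm, smul_eq_mul]
    field_simp
    ring
  nlinarith [sq_integral_abs_le hab hg]

theorem intervalAvg_sub {M : ℕ} (hM : 0 < M) {f g : ℝ → ℝ} (hf : ContinuousOn f (Icc 0 1))
    (hg : ContinuousOn g (Icc 0 1)) {i : ℕ} (hi : i ∈ Finset.Icc 1 M) :
    intervalAvg M (fun x => f x - g x) i = intervalAvg M f i - intervalAvg M g i := by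
  obtain ⟨h1, h2⟩ := Finset.mem_Icc.1 hi
  have hM' : (0 : ℝ) < M := by exact_mod_cast hM
  have h1' : (1 : ℝ) ≤ i := by exact_mod_cast h1
  have h2' : (i : ℝ) ≤ M := by exact_mod_cast h2
  have hsub : uIcc (((i : ℝ) - 1) / M) ((i : ℝ) / M) ⊆ Icc 0 1 := by
    rw [uIcc_of_le (by gcongr; linarith)]
    exact Icc_subset_Icc (div_nonneg (by linarith) hM'.le) ((div_le_one hM').2 h2')
  unfold intervalAvg
  rw [intervalIntegral.integral_sub (hf.mono hsub).intervalIntegrable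
    (hg.mono hsub).intervalIntegrable, mul_sub]

/-- The squared `L²` norm is controlled by the derivative and the cell averages. -/
theorem integral_sq_le_sum_intervalAvg {M : ℕ} (hM : 0 < M) {e g : ℝ → ℝ}
    (he : ContinuousOn e (Icc 0 1)) (hg : ContinuousOn g (Icc 0 1))
    (hd : ∀ x ∈ Ioo (0 : ℝ) 1, HasDerivAt e (g x) x) :
    ∫ x in (0 : ℝ)..1, e x ^ 2
      ≤ (1 / M : ℝ) ^ 2 * (∫ x in (0 : ℝ)..1, g x ^ 2)
        + (1 / M) * ∑ i ∈ Finset.Icc 1 M, intervalAvg M e i ^ 2 := by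
  have hM' : (0 : ℝ) < M := by exact_mod_cast hM
  have hend : (0 : ℝ) + M * (1 / M) = 1 := by field_simp; simp
  have hδ : (0 : ℝ) ≤ 1 / M := by positivity
  have e1 := sum_integral_grid (g := fun x => e x ^ 2) (a := 0) hδ M (by rw [hend]; exact he.pow 2)
  have e2 := sum_integral_grid (g := fun x => g x ^ 2) (a := 0) hδ M (by rw [hend]; exact hg.pow 2)
  rw [hend] at e1 e2
  have e3 := sum_Icc_add_one_eq_sum_range 0 M fun i => intervalAvg M e i ^ 2
  simp only [zero_add] at e3
  rw [← e1, ← e2, e3, Finset.mul_sum, Finset.mul_sum, ← Finset.sum_add_distrib]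
  refine Finset.sum_le_sum fun t ht => ?_
  have ht' : (t : ℝ) + 1 ≤ M := by exact_mod_cast Finset.mem_range.1 ht
  have hl : (0 : ℝ) + t * (1 / M) = t / M := by ring
  have hr : (0 : ℝ) + (t + 1 : ℕ) * (1 / M) = (t + 1) / M := by push_cast; ring
  rw [hl, hr]
  have hlo : (0 : ℝ) ≤ t / M := by positivity
  have hhi : ((t : ℝ) + 1) / M ≤ 1 := (div_le_one hM').2 ht'
  have hlt : (t : ℝ) / M < (t + 1) / M := by gcongr; linarith
  have hsub : Icc ((t : ℝ) / M) ((t + 1) / M) ⊆ Icc 0 1 := Icc_subset_Icc hlo hhi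
  have key := integral_sq_le_poincare hlt (he.mono hsub) (hg.mono hsub)
    fun x hx => hd x ⟨hlo.trans_lt hx.1, hx.2.trans_le hhi⟩
  have hlen : ((t : ℝ) + 1) / M - t / M = 1 / M := by ring
  rw [hlen] at key
  have hav : intervalAvg M e (t + 1) = M * ∫ x in ((t : ℝ) / M)..((t + 1) / M), e x := by
    simp [intervalAvg]
  rw [hav]
  refine key.trans_eq ?_
  field_simp

/-- Error of the right-endpoint rule for a function with derivative bounded by `Q`. -/
theorem abs_groupMean_sub_intervalAvg_le {M N : ℕ} (hM : 0 < M) (hN : 0 < N) {Q : ℝ}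
    {y : ℝ → ℝ} (hy : DifferentiableOn ℝ y (Icc 0 1))
    (hQ : ∀ x ∈ Icc (0:ℝ) 1, |derivWithin y (Icc 0 1) x| ≤ Q) {i : ℕ}
    (hi : i ∈ Finset.Icc 1 M) :
    |groupMean M N y i - intervalAvg M y i| ≤ Q * (1 / M) / N := by
  obtain ⟨h1, h2⟩ := Finset.mem_Icc.1 hi
  obtain ⟨s, rfl⟩ : ∃ s, i = s + 1 := ⟨i - 1, by omega⟩
  have hM' : (0 : ℝ) < M := by exact_mod_cast hM
  have hN' : (0 : ℝ) < N := by exact_mod_cast hN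
  have hs : (s : ℝ) + 1 ≤ M := by exact_mod_cast h2
  set δ : ℝ := 1 / (M * N) with hδ
  have hδ0 : 0 < δ := by positivity
  set a : ℝ := s / M with ha
  have ha0 : 0 ≤ a := by positivity
  have hend : a + N * δ = (s + 1) / M := by rw [ha, hδ]; field_simp
  have hend1 : a + N * δ ≤ 1 := by rw [hend]; exact (div_le_one hM').2 hs
  have hcont : ContinuousOn y (Icc a (a + N * δ)) :=
    hy.continuousOn.mono (Icc_subset_Icc ha0 hend1)
  have hgrp : groupMean M N y (s + 1)
      = M * ∑ t ∈ Finset.range N, ∫ _ in (a + t * δ)..(a + (t + 1 : ℕ) * δ),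
          y (a + (t + 1 : ℕ) * δ) := by
    have hidx : (s + 1) * N = s * N + N := by ring
    unfold groupMean
    rw [Nat.add_sub_cancel, hidx, sum_Icc_add_one_eq_sum_range, Finset.mul_sum, Finset.mul_sum]
    refine Finset.sum_congr rfl fun t _ => ?_
    have hp : ((s * N + t + 1 : ℕ) : ℝ) / (M * N) = a + (t + 1 : ℕ) * δ := by
      rw [ha, hδ]; push_cast; field_simp
      ring
    rw [hp, intervalIntegral.integral_const, smul_eq_mul]
    have hl : a + (t + 1 : ℕ) * δ - (a + t * δ) = δ := by push_cast; ring
    rw [hl, hδ]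
    field_simp
  have havg : intervalAvg M y (s + 1)
      = M * ∑ t ∈ Finset.range N, ∫ x in (a + t * δ)..(a + (t + 1 : ℕ) * δ), y x := by
    rw [sum_integral_grid hδ0.le N hcont, hend]
    simp [intervalAvg, ha]
  have hcell : ∀ t ∈ Finset.range N,
      |(∫ _ in (a + t * δ)..(a + (t + 1 : ℕ) * δ), y (a + (t + 1 : ℕ) * δ))
        - ∫ x in (a + t * δ)..(a + (t + 1 : ℕ) * δ), y x| ≤ Q * δ * δ := by
    intro t ht
    have h1 : ((t + 1 : ℕ) : ℝ) ≤ N := by exact_mod_cast Finset.mem_range.1 ht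
    have h2 : ((t + 1 : ℕ) : ℝ) * δ = t * δ + δ := by push_cast; ring
    have h3 : 0 ≤ (t : ℝ) * δ := by positivity
    have h4 : ((t + 1 : ℕ) : ℝ) * δ ≤ N * δ := by gcongr
    have hle : a + t * δ ≤ a + (t + 1 : ℕ) * δ := by linarith
    have hyi : IntervalIntegrable y volume (a + t * δ) (a + (t + 1 : ℕ) * δ) := by
      apply ContinuousOn.intervalIntegrable
      rw [uIcc_of_le hle]
      exact hcont.mono (Icc_subset_Icc (by linarith) (by linarith))
    rw [← intervalIntegral.integral_sub (by simp) hyi]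
    have hb : a + (t + 1 : ℕ) * δ ∈ Icc (0 : ℝ) 1 := ⟨by linarith, by linarith⟩
    have hQ0 : 0 ≤ Q := (abs_nonneg _).trans (hQ _ hb)
    have h5 := intervalIntegral.norm_integral_le_of_norm_le_const
      (f := fun x => y (a + (t + 1 : ℕ) * δ) - y x) (a := a + t * δ) (b := a + (t + 1 : ℕ) * δ)
      (C := Q * δ) fun x hx => by
        rw [uIoc_of_le hle] at hx
        have hx' : x ∈ Icc (0 : ℝ) 1 := ⟨by linarith [hx.1], by linarith [hx.2]⟩
        refine ((convex_Icc (0 : ℝ) 1).norm_image_sub_le_of_norm_derivWithin_le hy hQ hx' hb).trans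
          ?_
        gcongr
        rw [Real.norm_eq_abs, abs_of_nonneg (by linarith [hx.2])]
        linarith [hx.1]
    have hl : |a + (t + 1 : ℕ) * δ - (a + t * δ)| = δ := by
      rw [h2, add_sub_add_left_eq_sub, add_sub_cancel_left, abs_of_pos hδ0]
    rwa [hl] at h5
  rw [hgrp, havg, ← mul_sub, ← Finset.sum_sub_distrib, abs_mul, abs_of_pos hM']
  calc (M : ℝ) * _ ≤ M * ∑ _t ∈ Finset.range N, Q * δ * δ := by
        gcongr
        exact (Finset.abs_sum_le_sum_abs _ _).trans (Finset.sum_le_sum hcell)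
    _ = Q * (1 / M) / N := by
        rw [Finset.sum_const, Finset.card_range, nsmul_eq_mul, hδ]
        field_simp

/-- Estimate `‖e‖ ≤ h_M‖e'‖ + sqrt(8Δ_M² + 8Q²h_M²/N² + 2α‖y^{(k)}‖²)` for
`e = f_* − y`, where `f_*` satisfies `Φ(f_*) ≤ Φ(y)`. -/
theorem L2_error_bound (k M N : ℕ) (hk : 2 ≤ k) (hM : 2 ≤ M) (hN : 1 ≤ N)
    (α : ℝ) (hα : 0 < α) (Ytil : ℕ → ℝ) (Q : ℝ) (y fstar : ℝ → ℝ)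
    (hy : ContDiffOn ℝ k y (Icc 0 1))
    (hQ : ∀ x ∈ Icc (0:ℝ) 1, |derivWithin y (Icc 0 1) x| ≤ Q)
    (hf : ContDiffOn ℝ k fstar (Icc 0 1))
    (hb0 : fstar 0 = y 0) (hb1 : fstar 1 = y 1)
    (hmin : tikhonov M k α Ytil fstar ≤ tikhonov M k α Ytil y) :
    l2norm (fun x => fstar x - y x)
      ≤ (1 / M : ℝ) * l2norm (derivWithin (fun x => fstar x - y x) (Icc 0 1))
        + Real.sqrt (8 * deltaSq M N Ytil y
            + 8 * Q ^ 2 * (1 / M : ℝ) ^ 2 / N ^ 2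
            + 2 * α * l2norm (iteratedDerivWithin k y (Icc 0 1)) ^ 2) := by
  have hM0 : 0 < M := by omega
  have hM' : (0 : ℝ) < M := by exact_mod_cast hM0
  have hN' : (0 : ℝ) < N := by exact_mod_cast hN
  have hk1 : (1 : WithTop ℕ∞) ≤ k := by exact_mod_cast (by omega : 1 ≤ k)
  have hU : UniqueDiffOn ℝ (Icc (0 : ℝ) 1) := uniqueDiffOn_Icc zero_lt_one
  have heC : ContDiffOn ℝ k (fun x => fstar x - y x) (Icc 0 1) := hf.sub hy
  have hed : DifferentiableOn ℝ (fun x => fstar x - y x) (Icc 0 1) :=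
    heC.differentiableOn (by positivity)
  have hyd : DifferentiableOn ℝ y (Icc 0 1) := hy.differentiableOn (by positivity)
  have hpoinc := integral_sq_le_sum_intervalAvg hM0 heC.continuousOn
    (heC.continuousOn_derivWithin hU hk1) fun x hx =>
      (hed x (Ioo_subset_Icc_self hx)).hasDerivWithinAt.hasDerivAt (Icc_mem_nhds hx.1 hx.2)
  have hquad : ∀ i ∈ Finset.Icc 1 M,
      intervalAvg M (fun x => fstar x - y x) i ^ 2
        ≤ 2 * (Ytil i - intervalAvg M fstar i) ^ 2 - 2 * (Ytil i - intervalAvg M y i) ^ 2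
          + 8 * (Ytil i - groupMean M N y i) ^ 2 + 8 * (Q * (1 / M) / N) ^ 2 := by
    intro i hi
    rw [intervalAvg_sub hM0 hf.continuousOn hy.continuousOn hi]
    have hq : (groupMean M N y i - intervalAvg M y i) ^ 2 ≤ (Q * (1 / M) / N) ^ 2 := by
      rw [← sq_abs]
      exact pow_le_pow_left₀ (abs_nonneg _) (abs_groupMean_sub_intervalAvg_le hM0 hN hyd hQ hi) 2
    nlinarith [sq_nonneg ((Ytil i - intervalAvg M fstar i) + (Ytil i - intervalAvg M y i)),
      sq_nonneg ((Ytil i - groupMean M N y i) - (groupMean M N y i - intervalAvg M y i))]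
  have havg : (1 / M : ℝ) * ∑ i ∈ Finset.Icc 1 M, intervalAvg M (fun x => fstar x - y x) i ^ 2
      ≤ 8 * deltaSq M N Ytil y + 8 * Q ^ 2 * (1 / M : ℝ) ^ 2 / N ^ 2
        + 2 * α * l2norm (iteratedDerivWithin k y (Icc 0 1)) ^ 2 := by
    have hsum := mul_le_mul_of_nonneg_left (Finset.sum_le_sum hquad)
      (by positivity : (0 : ℝ) ≤ 1 / M)
    simp only [Finset.sum_add_distrib, Finset.sum_sub_distrib, ← Finset.mul_sum,
      Finset.sum_const, Nat.card_Icc, Nat.add_sub_cancel, nsmul_eq_mul] at hsum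
    have hconst : (1 / M : ℝ) * (8 * (M * (Q * (1 / M) / N) ^ 2))
        = 8 * Q ^ 2 * (1 / M : ℝ) ^ 2 / N ^ 2 := by
      field_simp
    have hpos : 0 ≤ α * ∫ x in (0:ℝ)..1, (iteratedDerivWithin k fstar (Icc 0 1) x) ^ 2 :=
      mul_nonneg hα.le (intervalIntegral.integral_nonneg zero_le_one fun x _ => sq_nonneg _)
    rw [l2norm_sq, deltaSq]
    unfold tikhonov at hmin
    linarith
  have hsplit : (∫ x in (0:ℝ)..1, (fstar x - y x) ^ 2)
      ≤ (1 / M : ℝ) ^ 2 * (∫ x in (0:ℝ)..1, derivWithin (fun x => fstar x - y x) (Icc 0 1) x ^ 2)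
        + (8 * deltaSq M N Ytil y + 8 * Q ^ 2 * (1 / M : ℝ) ^ 2 / N ^ 2
          + 2 * α * l2norm (iteratedDerivWithin k y (Icc 0 1)) ^ 2) := by
    linarith
  have hB := (mul_nonneg (by positivity : (0 : ℝ) ≤ 1 / M)
    (Finset.sum_nonneg fun i _ => sq_nonneg _)).trans havg
  refine (Real.sqrt_le_sqrt hsplit).trans ?_
  have hD : 0 ≤ l2norm (derivWithin (fun x => fstar x - y x) (Icc 0 1)) := Real.sqrt_nonneg _
  refine (Real.sqrt_le_left (by positivity)).2 ?_
  rw [add_sq, mul_pow, Real.sq_sqrt hB, ← l2norm_sq]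
  have : 0 ≤ 2 * (1 / M * l2norm (derivWithin (fun x => fstar x - y x) (Icc 0 1)))
      * √(8 * deltaSq M N Ytil y + 8 * Q ^ 2 * (1 / M : ℝ) ^ 2 / N ^ 2
        + 2 * α * l2norm (iteratedDerivWithin k y (Icc 0 1)) ^ 2) := by positivity
  linarith
end

section
/- Let σ > 0, let M ≥ 2 and N ≥ 1 be integers, let 0 < p < 1, and let z̄_{M,p} be the unique solution in (1, ∞) of x·e^{1−x} = p^{2/M}. Let η_1,…,η_{MN} be independent Gaussian random variables with mean 0 and variance σ², and define Δ_M² := (1/M)·Σ_{i=1}^{M} ((1/N)·Σ_{j=(i−1)N+1}^{iN} η_j)². Then P(Δ_M² ≤ z̄_{M,p}·σ²/N) ≥ 1 − p. -/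
open MeasureTheory ProbabilityTheory

open scoped NNReal

/-- Uncurrying is measure preserving from an iterated product of a probability measure to the
product over pairs of indices. -/
lemma measurePreserving_uncurry_pi {ι κ E : Type*} [Fintype ι] [Fintype κ] [MeasurableSpace E]
    (P : Measure E) [IsProbabilityMeasure P] :
    MeasurePreserving (fun (ω : ι → κ → E) (q : ι × κ) => ω q.1 q.2)
      (Measure.pi fun _ => Measure.pi fun _ => P) (Measure.pi fun _ => P) := by
  refine ⟨by fun_prop, ?_⟩
  have hmp (i : ι) (j : κ) : MeasurePreserving (fun ω : ι → κ → E => ω i j)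
      (Measure.pi fun _ => Measure.pi fun _ => P) P :=
    (measurePreserving_eval (fun _ : κ => P) j).comp
      (measurePreserving_eval (fun _ : ι => Measure.pi fun _ : κ => P) i)
  have hinner (i : ι) : iIndepFun (fun (j : κ) (ω : ι → κ → E) => ω i j)
      (Measure.pi fun _ => Measure.pi fun _ => P) := by
    rw [iIndepFun_iff_map_fun_eq_pi_map fun j => (hmp i j).measurable.aemeasurable]
    simp_rw [(hmp i _).map_eq]
    exact (measurePreserving_eval (fun _ : ι => Measure.pi fun _ : κ => P) i).map_eq
  have houter : iIndepFun (fun (i : ι) (ω : ι → κ → E) => (ω i ·))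
      (Measure.pi fun _ => Measure.pi fun _ => P) :=
    iIndepFun_pi (X := fun _ x => x) (by fun_prop)
  have h := (iIndepFun_uncurry' (X := fun i j (ω : ι → κ → E) => ω i j)
    (fun i j => (hmp i j).measurable) houter hinner).map_fun_eq_pi_map
    fun q : ι × κ => (hmp q.1 q.2).measurable.aemeasurable
  simpa only [(hmp _ _).map_eq] using h

/-- The sample mean of independent `N(0, v)` variables has law `N(0, v / n)`. -/
lemma map_mean_pi_gaussianReal {κ : Type*} [Fintype κ] [Nonempty κ] (v : ℝ≥0) :
    (Measure.pi fun _ : κ => gaussianReal 0 v).map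
        (fun x => (1 / Fintype.card κ : ℝ) * ∑ j, x j) =
      gaussianReal 0 (v / Fintype.card κ) := by
  have hind : iIndepFun (fun (j : κ) (x : κ → ℝ) => x j) (Measure.pi fun _ => gaussianReal 0 v) :=
    iIndepFun_pi (X := fun _ x => x) (by fun_prop)
  have hsum : (Measure.pi fun _ : κ => gaussianReal 0 v).map (fun x => ∑ j, x j) =
      gaussianReal 0 (Fintype.card κ * v) := by
    refine Measure.ext_of_charFun ?_
    rw [hind.charFun_map_fun_sum_eq_prod fun j => (measurable_pi_apply j).aemeasurable]
    ext t
    simp_rw [(measurePreserving_eval (fun _ : κ => gaussianReal 0 v) _).map_eq]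
    simp only [Finset.prod_apply, charFun_gaussianReal, Finset.prod_const, Finset.card_univ]
    rw [← Complex.exp_nat_mul]
    push_cast
    ring_nf
  have hmap := Measure.map_map (μ := Measure.pi fun _ : κ => gaussianReal 0 v)
    (g := fun y : ℝ => (1 / Fintype.card κ : ℝ) * y) (f := fun x => ∑ j, x j)
    (by fun_prop) (by fun_prop)
  rw [hsum, gaussianReal_map_const_mul] at hmap
  refine hmap.symm.trans ?_
  congr 1
  · simp
  · ext
    push_cast
    field_simp

/-- The moment generating function of the square of a centred Gaussian variable. -/
lemma mgf_sq_gaussianReal {v : ℝ≥0} (hv : v ≠ 0) {t : ℝ} (ht : 2 * t * v < 1) :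
    mgf (fun x => x ^ 2) (gaussianReal 0 v) t = (√(1 - 2 * t * v))⁻¹ := by
  have hv' : (0 : ℝ) < v := by positivity
  rw [mgf, integral_gaussianReal_eq_integral_smul hv]
  have hfun (x : ℝ) : gaussianPDFReal 0 v x • Real.exp (t * x ^ 2) =
      (√(2 * Real.pi * v))⁻¹ * Real.exp (-((1 - 2 * t * v) / (2 * v)) * x ^ 2) := by
    rw [gaussianPDFReal_def, smul_eq_mul, mul_assoc, ← Real.exp_add]
    congr 2
    field_simp
    ring
  simp_rw [hfun]
  rw [integral_const_mul, integral_gaussian, ← Real.sqrt_inv, ← Real.sqrt_inv,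
    ← Real.sqrt_mul (by positivity)]
  have : 1 - 2 * t * v ≠ 0 := by linarith
  congr 1
  field_simp

/-- Chernoff bound for a sum of squares of independent centred Gaussian variables. -/
lemma measureReal_sum_sq_ge_le {Ω ι : Type*} [Fintype ι] {mΩ : MeasurableSpace Ω}
    {P : Measure Ω} [IsProbabilityMeasure P] {X : ι → Ω → ℝ} (hX : ∀ i, Measurable (X i))
    (hind : iIndepFun X P) {v : ℝ≥0} (hv : v ≠ 0) (hlaw : ∀ i, P.map (X i) = gaussianReal 0 v)
    {z : ℝ} (hz : 1 ≤ z) :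
    P.real {ω | Fintype.card ι * (z * v) ≤ ∑ i, X i ω ^ 2} ≤
      (z * Real.exp (1 - z)) ^ ((Fintype.card ι : ℝ) / 2) := by
  have hv' : (0 : ℝ) < v := by positivity
  have hz0 : 0 < z := by linarith
  set t : ℝ := (1 - z⁻¹) / (2 * v) with ht_def
  have htv : 1 - 2 * t * v = z⁻¹ := by rw [ht_def]; field_simp; ring
  have ht : 0 ≤ t := by
    have : z⁻¹ ≤ 1 := inv_le_one_of_one_le₀ hz
    exact div_nonneg (by linarith) (by positivity)
  have hmgf (i : ι) : mgf (fun ω => X i ω ^ 2) P t = √z := by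
    have h := mgf_map (μ := P) (Y := X i) (X := fun x : ℝ => x ^ 2) (t := t)
      (hX i).aemeasurable (by fun_prop)
    rw [hlaw, mgf_sq_gaussianReal hv (by have := inv_pos.2 hz0; linarith), htv,
      Real.sqrt_inv, inv_inv] at h
    exact h.symm
  have hind' : iIndepFun (fun i ω => X i ω ^ 2) P :=
    hind.comp (fun _ x => x ^ 2) (by fun_prop)
  have hsum : mgf (fun ω => ∑ i, X i ω ^ 2) P t = z ^ ((Fintype.card ι : ℝ) / 2) := by
    have h := hind'.mgf_sum (t := t) (by fun_prop) Finset.univ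
    simp only [hmgf, Finset.prod_const, Finset.card_univ] at h
    convert! h using 1
    · congr 1; ext ω; simp
    · rw [Real.sqrt_eq_rpow, ← Real.rpow_natCast, ← Real.rpow_mul hz0.le]
      ring_nf
  have hint : Integrable (fun ω => Real.exp (t * ∑ i, X i ω ^ 2)) P := by
    rw [← mgf_pos_iff, hsum]
    positivity
  refine (measure_ge_le_exp_mul_mgf _ ht hint).trans_eq ?_
  rw [hsum, Real.mul_rpow hz0.le (Real.exp_pos _).le, ← Real.exp_mul, mul_comm]
  congr 2
  rw [ht_def]
  field_simp
  ring

/-- Confidence bound for the mean of the squared block averages of Gaussian noise. -/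
lemma pi_gaussianReal_mean_sq_le {M N : ℕ} [NeZero M] [NeZero N] {v : ℝ≥0} (hv : v ≠ 0) {p z : ℝ}
    (hp0 : 0 < p) (hz1 : 1 < z) (hze : z * Real.exp (1 - z) = p ^ ((2 : ℝ) / M)) :
    ENNReal.ofReal (1 - p) ≤
      (Measure.pi fun _ : Fin M × Fin N => gaussianReal 0 v)
        {η : Fin M × Fin N → ℝ |
          (1 / M : ℝ) * ∑ i : Fin M, ((1 / N : ℝ) * ∑ j : Fin N, η (i, j)) ^ 2
            ≤ z * v / N} := by
  have hM0 : (0 : ℝ) < M := Nat.cast_pos.2 (NeZero.pos M)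
  have hvN : v / N ≠ 0 := div_ne_zero hv (NeZero.ne _)
  have hind : iIndepFun (fun (i : Fin M) (ω : Fin M → Fin N → ℝ) => (1 / N : ℝ) * ∑ j, ω i j)
      (Measure.pi fun _ => Measure.pi fun _ => gaussianReal 0 v) :=
    iIndepFun_pi (μ := fun _ : Fin M => Measure.pi fun _ : Fin N => gaussianReal 0 v)
      (X := fun _ x => (1 / N : ℝ) * ∑ j, x j)
      fun _ => Measurable.aemeasurable (by fun_prop)
  have hlaw (i : Fin M) : (Measure.pi fun _ : Fin M => Measure.pi fun _ : Fin N =>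
      gaussianReal 0 v).map (fun ω => (1 / N : ℝ) * ∑ j, ω i j) = gaussianReal 0 (v / N) := by
    have h := map_mean_pi_gaussianReal (κ := Fin N) v
    rw [Fintype.card_fin, ← (measurePreserving_eval (fun _ : Fin M => Measure.pi fun _ : Fin N =>
      gaussianReal 0 v) i).map_eq, Measure.map_map (by fun_prop) (by fun_prop)] at h
    exact h
  have htail := measureReal_sum_sq_ge_le (by fun_prop) hind hvN hlaw hz1.le
  rw [hze, Fintype.card_fin, ← Real.rpow_mul hp0.le, div_mul_div_cancel₀ hM0.ne',
    div_self two_ne_zero, Real.rpow_one] at htail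
  have hmp := measurePreserving_uncurry_pi (ι := Fin M) (κ := Fin N) (gaussianReal 0 v)
  rw [← hmp.measure_preimage (measurableSet_le (by fun_prop) (by fun_prop)).nullMeasurableSet]
  refine ENNReal.ofReal_le_of_le_toReal ?_
  rw [← Measure.real]
  have hmeas : MeasurableSet {ω : Fin M → Fin N → ℝ |
      M * (z * ((v / N : ℝ≥0) : ℝ)) ≤ ∑ i, ((1 / N : ℝ) * ∑ j, ω i j) ^ 2} :=
    measurableSet_le (by fun_prop) (by fun_prop)
  have hcompl := probReal_compl_eq_one_sub
    (μ := Measure.pi fun _ : Fin M => Measure.pi fun _ : Fin N => gaussianReal 0 v) hmeas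
  refine ((sub_le_sub_left htail 1).trans_eq hcompl.symm).trans (measureReal_mono fun ω hω => ?_)
  simp only [Set.mem_compl_iff, Set.mem_ofPred_eq, not_le] at hω
  simp only [Set.mem_preimage, Set.mem_ofPred_eq]
  push_cast at hω
  rw [one_div_mul_eq_div, div_le_iff₀ hM0]
  exact hω.le.trans_eq (by ring)

/-- For iid Gaussian noise `η_{i,j} ∼ N(0,σ²)` (`i = 1,…,M`, `j = 1,…,N`) and the
statistic `Δ_M² = (1/M)∑_i ((1/N)∑_j η_{i,j})²`, if `z̄_{M,p} ∈ (1,∞)` solves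
`x·e^{1−x} = p^{2/M}`, then `P(Δ_M² ≤ z̄_{M,p}·σ²/N) ≥ 1 − p`. -/
theorem deltaSq_confidence (σ : ℝ) (hσ : 0 < σ) (M N : ℕ) (hM : 2 ≤ M) (hN : 1 ≤ N)
    (p : ℝ) (hp0 : 0 < p) (hp1 : p < 1) (z : ℝ) (hz1 : 1 < z)
    (hze : z * Real.exp (1 - z) = p ^ ((2 : ℝ) / M)) :
    ENNReal.ofReal (1 - p) ≤
      (Measure.pi fun _ : Fin M × Fin N => gaussianReal 0 ⟨σ ^ 2, sq_nonneg σ⟩)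
        {η : Fin M × Fin N → ℝ |
          (1 / M : ℝ) * ∑ i : Fin M, ((1 / N : ℝ) * ∑ j : Fin N, η (i, j)) ^ 2
            ≤ z * σ ^ 2 / N} := by
  have : NeZero M := ⟨by lia⟩
  have : NeZero N := ⟨by lia⟩
  have hv : (⟨σ ^ 2, sq_nonneg σ⟩ : ℝ≥0) ≠ 0 := NNReal.coe_ne_zero.1 (pow_pos hσ 2).ne'
  exact pi_gaussianReal_mean_sq_le hv hp0 hz1 hze
end
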